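/- Assume u₋ is strictly concave at 0 and the finiteness condition holds. If (c*, x₊*) is an optimal solution of Problem (M) and X₊* is an optimal solution of the positive part problem with parameters ({ρ ≤ c*}, x₊*), then X* := X₊*·1_{ρ≤c*} − ((x₊* − x₀)/E[ρ·1_{ρ>c*}])·1_{ρ>c*} is an optimal solution of Problem (P). -/

import Mathlib

open MeasureTheory Set Filter
open scoped ENNReal symmDiff

noncomputable section

/-- The data of the continuous-time behavioral portfolio selection model:
a probability space, the pricing kernel `ρ`, the utilities `up = u₊`, `um = u₋`
(with the derivatives `up'`, `up''` of `u₊`), the probability distortions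
`Tp = T₊`, `Tm = T₋`, and the initial endowment `x0`. -/
structure BSetup (Ω : Type*) [MeasurableSpace Ω] where
  P : MeasureTheory.Measure Ω
  isProb : MeasureTheory.IsProbabilityMeasure P
  ρ : Ω → ℝ
  meas_ρ : Measurable ρ
  ρ_pos : ∀ᵐ ω ∂P, 0 < ρ ω
  ρ_int : MeasureTheory.Integrable ρ P
  Eρ_pos : 0 < ∫ ω, ρ ω ∂P
  ρ_atomless : ∀ a : ℝ, P {ω | ρ ω = a} = 0
  up : ℝ → ℝ
  um : ℝ → ℝ
  up' : ℝ → ℝ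
  up'' : ℝ → ℝ
  up_mono : StrictMonoOn up (Set.Ici 0)
  um_mono : StrictMonoOn um (Set.Ici 0)
  up_concave : ConcaveOn ℝ (Set.Ici 0) up
  um_concave : ConcaveOn ℝ (Set.Ici 0) um
  up_zero : up 0 = 0
  um_zero : um 0 = 0
  up_sconcave : StrictConcaveOn ℝ (Set.Ici 0) up
  up_deriv : ∀ x ∈ Set.Ioi (0:ℝ), HasDerivAt up (up' x) x
  up_deriv2 : ∀ x ∈ Set.Ioi (0:ℝ), HasDerivAt up' (up'' x) x
  up'_zero : Filter.Tendsto up' (nhdsWithin 0 (Set.Ioi 0)) Filter.atTop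
  up'_atTop : Filter.Tendsto up' Filter.atTop (nhds 0)
  Tp : ℝ → ℝ
  Tm : ℝ → ℝ
  Tp_mono : StrictMonoOn Tp (Set.Icc 0 1)
  Tm_mono : StrictMonoOn Tm (Set.Icc 0 1)
  Tp_diff : DifferentiableOn ℝ Tp (Set.Icc 0 1)
  Tm_diff : DifferentiableOn ℝ Tm (Set.Icc 0 1)
  Tp_zero : Tp 0 = 0
  Tm_zero : Tm 0 = 0
  Tp_one : Tp 1 = 1
  Tm_one : Tm 1 = 1
  x0 : ℝ

variable {Ω : Type*} [MeasurableSpace Ω]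

/-- `V₊(Y) = ∫₀^∞ T₊(P{u₊(Y) > y}) dy`, as a value in `[0,∞]`. -/
def Vpl (S : BSetup Ω) (Y : Ω → ℝ) : ℝ≥0∞ :=
  ∫⁻ y in Set.Ioi (0:ℝ), ENNReal.ofReal (S.Tp ((S.P {ω | y < S.up (Y ω)}).toReal))

/-- `V₋(Y) = ∫₀^∞ T₋(P{u₋(Y) > y}) dy`, as a value in `[0,∞]`. -/
def Vmn (S : BSetup Ω) (Y : Ω → ℝ) : ℝ≥0∞ :=
  ∫⁻ y in Set.Ioi (0:ℝ), ENNReal.ofReal (S.Tm ((S.P {ω | y < S.um (Y ω)}).toReal))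

/-- `V(X) = V₊(X⁺) − V₋(X⁻)`, an extended real number. -/
def Vval (S : BSetup Ω) (X : Ω → ℝ) : EReal :=
  (Vpl S (fun ω => max (X ω) 0)).toEReal - (Vmn S (fun ω => max (-X ω) 0)).toEReal

/-- Feasibility for Problem (P): `X` is a random variable, a.s. bounded below,
with `E[ρX] = x₀`. -/
def FeasP (S : BSetup Ω) (X : Ω → ℝ) : Prop :=
  AEMeasurable X S.P ∧ (∃ b : ℝ, ∀ᵐ ω ∂S.P, b ≤ X ω) ∧
    MeasureTheory.Integrable (fun ω => S.ρ ω * X ω) S.P ∧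
    (∫ ω, S.ρ ω * X ω ∂S.P) = S.x0

/-- The supremum value of Problem (P). -/
def supP (S : BSetup Ω) : EReal :=
  sSup {v : EReal | ∃ X : Ω → ℝ, FeasP S X ∧ v = Vval S X}

/-- Problem (P) is ill-posed if its supremum value is `+∞`. -/
def IllposedP (S : BSetup Ω) : Prop := supP S = ⊤

/-- `X` is an optimal solution of Problem (P). -/
def OptimalP (S : BSetup Ω) (X : Ω → ℝ) : Prop :=
  FeasP S X ∧ ∀ Y : Ω → ℝ, FeasP S Y → Vval S Y ≤ Vval S X

/-- Feasibility for the positive part problem with parameters `(A, x₊)`. -/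
def FeasPos (S : BSetup Ω) (A : Set Ω) (xp : ℝ) (X : Ω → ℝ) : Prop :=
  AEMeasurable X S.P ∧ (∀ᵐ ω ∂S.P, 0 ≤ X ω) ∧
    MeasureTheory.Integrable (fun ω => S.ρ ω * X ω) S.P ∧
    (∫ ω, S.ρ ω * X ω ∂S.P) = xp ∧
    (∀ᵐ ω ∂S.P, ω ∉ A → X ω = 0)

/-- Optimality for the positive part problem with parameters `(A, x₊)`. -/
def OptPos (S : BSetup Ω) (A : Set Ω) (xp : ℝ) (X : Ω → ℝ) : Prop :=
  FeasPos S A xp X ∧ ∀ Y : Ω → ℝ, FeasPos S A xp Y → Vpl S Y ≤ Vpl S X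

/-- The value `v₊(A, x₊)` of the positive part problem. -/
def vPos (S : BSetup Ω) (A : Set Ω) (xp : ℝ) : EReal :=
  if S.P A = 0 then (if xp = 0 then 0 else ⊥)
  else sSup {v : EReal | ∃ X : Ω → ℝ, FeasPos S A xp X ∧ v = (Vpl S X).toEReal}

/-- Feasibility for the negative part problem with parameters `(A, x₊)`. -/
def FeasNeg (S : BSetup Ω) (A : Set Ω) (xp : ℝ) (X : Ω → ℝ) : Prop :=
  AEMeasurable X S.P ∧ (∀ᵐ ω ∂S.P, 0 ≤ X ω) ∧ (∃ b : ℝ, ∀ᵐ ω ∂S.P, X ω ≤ b) ∧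
    MeasureTheory.Integrable (fun ω => S.ρ ω * X ω) S.P ∧
    (∫ ω, S.ρ ω * X ω ∂S.P) = xp - S.x0 ∧
    (∀ᵐ ω ∂S.P, ω ∈ A → X ω = 0)

/-- Optimality for the negative part problem with parameters `(A, x₊)`. -/
def OptNeg (S : BSetup Ω) (A : Set Ω) (xp : ℝ) (X : Ω → ℝ) : Prop :=
  FeasNeg S A xp X ∧ ∀ Y : Ω → ℝ, FeasNeg S A xp Y → Vmn S X ≤ Vmn S Y

/-- The value `v₋(A, x₊)` of the negative part problem. -/
def vNeg (S : BSetup Ω) (A : Set Ω) (xp : ℝ) : EReal :=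
  if S.P A = 1 then (if xp = S.x0 then 0 else ⊤)
  else sInf {v : EReal | ∃ X : Ω → ℝ, FeasNeg S A xp X ∧ v = (Vmn S X).toEReal}

/-- Feasibility for Problem (S). -/
def FeasS (S : BSetup Ω) (A : Set Ω) (xp : ℝ) : Prop :=
  MeasurableSet A ∧ max S.x0 0 ≤ xp ∧ (S.P A = 0 → xp = 0) ∧ (S.P A = 1 → xp = S.x0)

/-- The objective of Problem (S): `v₊(A, x₊) − v₋(A, x₊)`. -/
def objS (S : BSetup Ω) (A : Set Ω) (xp : ℝ) : EReal := vPos S A xp - vNeg S A xp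

/-- The supremum value of Problem (S). -/
def supS (S : BSetup Ω) : EReal :=
  sSup {v : EReal | ∃ (A : Set Ω) (xp : ℝ), FeasS S A xp ∧ v = objS S A xp}

/-- Optimality for Problem (S). -/
def OptS (S : BSetup Ω) (A : Set Ω) (xp : ℝ) : Prop :=
  FeasS S A xp ∧ ∀ (B : Set Ω) (yp : ℝ), FeasS S B yp → objS S B yp ≤ objS S A xp

/-- `ρ̄ = esssup ρ` (an extended real number). -/
def rhoBar (S : BSetup Ω) : EReal := essSup (fun ω => (S.ρ ω : EReal)) S.P

/-- `ρ̲ = essinf ρ` (an extended real number). -/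
def rhoLow (S : BSetup Ω) : EReal := essInf (fun ω => (S.ρ ω : EReal)) S.P

/-- The event `{ρ ≤ c}`. -/
def lev (S : BSetup Ω) (c : EReal) : Set Ω := {ω | (S.ρ ω : EReal) ≤ c}

/-- Feasibility of `(c, x₊)` for Problems (S_c) and (M). -/
def FeasSc (S : BSetup Ω) (c : EReal) (xp : ℝ) : Prop :=
  rhoLow S ≤ c ∧ c ≤ rhoBar S ∧ max S.x0 0 ≤ xp ∧
    (c = rhoLow S → xp = 0) ∧ (c = rhoBar S → xp = S.x0)

/-- The objective of Problem (S_c): `v₊(c, x₊) − v₋(c, x₊)`. -/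
def objSc (S : BSetup Ω) (c : EReal) (xp : ℝ) : EReal :=
  vPos S (lev S c) xp - vNeg S (lev S c) xp

/-- Optimality for Problem (S_c). -/
def OptSc (S : BSetup Ω) (c : EReal) (xp : ℝ) : Prop :=
  FeasSc S c xp ∧ ∀ (c' : EReal) (xp' : ℝ), FeasSc S c' xp' → objSc S c' xp' ≤ objSc S c xp

/-- The supremum value of Problem (S_c). -/
def supSc (S : BSetup Ω) : EReal :=
  sSup {v : EReal | ∃ (c : EReal) (xp : ℝ), FeasSc S c xp ∧ v = objSc S c xp}

/-- The distribution function `F` of `ρ`. -/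
def Fdist (S : BSetup Ω) (x : ℝ) : ℝ := (S.P {ω | S.ρ ω ≤ x}).toReal

/-- The distribution function of `ρ` evaluated at an extended real `c`. -/
def FdistE (S : BSetup Ω) (c : EReal) : ℝ := (S.P {ω | (S.ρ ω : EReal) ≤ c}).toReal

/-- `E[ρ·1_{ρ>c}]`. -/
def ERhoGt (S : BSetup Ω) (c : EReal) : ℝ :=
  ∫ ω, (if c < (S.ρ ω : EReal) then S.ρ ω else 0) ∂S.P

/-- The objective of Problem (M):
`v₊(c, x₊) − u₋((x₊−x₀)/E[ρ1_{ρ>c}])·T₋(1−F(c))`.  (When `c = ρ̄` and `x₊ = x₀`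
the subtracted term vanishes, realizing the convention of the paper.) -/
def objM (S : BSetup Ω) (c : EReal) (xp : ℝ) : EReal :=
  vPos S (lev S c) xp -
    ((S.um ((xp - S.x0) / ERhoGt S c) * S.Tm (1 - FdistE S c) : ℝ) : EReal)

/-- Optimality for Problem (M). -/
def OptM (S : BSetup Ω) (c : EReal) (xp : ℝ) : Prop :=
  FeasSc S c xp ∧ ∀ (c' : EReal) (xp' : ℝ), FeasSc S c' xp' → objM S c' xp' ≤ objM S c xp

/-- The supremum value of Problem (M). -/
def supM (S : BSetup Ω) : EReal :=
  sSup {v : EReal | ∃ (c : EReal) (xp : ℝ), FeasSc S c xp ∧ v = objM S c xp}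

/-- The generalized inverse `F⁻¹(z) = inf{y ≥ 0 : F(y) ≥ z}` of the distribution
function of `ρ`, valued in the extended reals (`= +∞` if no such `y` exists). -/
def FinvE (S : BSetup Ω) (z : ℝ) : EReal :=
  sInf {c : EReal | ∃ y : ℝ, 0 ≤ y ∧ z ≤ Fdist S y ∧ c = (y : EReal)}

/-- The finiteness condition: `V₊(X) < ∞` whenever `X ≥ 0` a.s. and `E[ρX] < ∞`. -/
def FinCond (S : BSetup Ω) : Prop :=
  ∀ X : Ω → ℝ, AEMeasurable X S.P → (∀ᵐ ω ∂S.P, 0 ≤ X ω) →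
    MeasureTheory.Integrable (fun ω => S.ρ ω * X ω) S.P → Vpl S X < ⊤

/-- `u` is strictly concave at `0`: `u(λx) > λu(x)` for `x > 0`, `λ ∈ (0,1)`. -/
def StrictConcaveAtZero (u : ℝ → ℝ) : Prop :=
  ∀ x : ℝ, 0 < x → ∀ l : ℝ, 0 < l → l < 1 → l * u x < u (l * x)

theorem ConcaveOn.exists_supergradient {u : ℝ → ℝ} (hu : ConcaveOn ℝ (Ici 0) u) {t : ℝ}
    (ht : 0 < t) : ∃ k : ℝ, ∀ y, 0 ≤ y → u y ≤ u t + k * (y - t) := by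
  set D : Set ℝ := {z | ∃ y, t < y ∧ z = (u y - u t) / (y - t)} with hD
  have hub : ∀ x, 0 ≤ x → x < t → (u t - u x) / (t - x) ∈ upperBounds D := by
    rintro x hx hxt z ⟨y, hy, rfl⟩
    exact hu.slope_anti_adjacent (mem_Ici.2 hx) (mem_Ici.2 (ht.le.trans hy.le)) hxt hy
  have hne : D.Nonempty := ⟨_, t + 1, by linarith, rfl⟩
  refine ⟨sSup D, fun y hy => ?_⟩
  rcases lt_trichotomy y t with h | h | h
  · have h1 := csSup_le hne (hub y hy h)
    rw [le_div_iff₀ (by linarith)] at h1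
    linarith
  · simp [h]
  · have h1 := le_csSup ⟨_, hub 0 le_rfl ht⟩ (show (u y - u t) / (y - t) ∈ D from ⟨y, h, rfl⟩)
    rw [div_le_iff₀ (by linarith)] at h1
    linarith

/-- A set on which the density is everywhere smaller than off it minimizes the weighted measure
among the sets of equal measure. -/
theorem withDensity_le_of_measure_eq {α : Type*} [MeasurableSpace α] {μ : Measure α}
    [IsFiniteMeasure μ] {f : α → ℝ≥0∞} {B C : Set α} (hB : MeasurableSet B)
    (hC : MeasurableSet C) (hBC : μ C = μ B) (c : ℝ≥0∞) (hle : ∀ x ∈ C \ B, f x ≤ c)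
    (hge : ∀ x ∈ B \ C, c ≤ f x) : μ.withDensity f C ≤ μ.withDensity f B := by
  have h1 : μ.withDensity f (C \ B) ≤ μ.withDensity f (B \ C) := by
    rw [withDensity_apply _ (hC.diff hB), withDensity_apply _ (hB.diff hC)]
    calc ∫⁻ x in C \ B, f x ∂μ ≤ ∫⁻ _ in C \ B, c ∂μ :=
          setLIntegral_mono measurable_const hle
      _ = c * μ (C \ B) := by simp
      _ = c * μ (B \ C) := by
          congr 1
          have h2 := measure_inter_add_sdiff (μ := μ) C hB
          have h3 := measure_inter_add_sdiff (μ := μ) B hC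
          rw [hBC, ← h3, inter_comm] at h2
          exact (ENNReal.add_right_inj (measure_ne_top _ _)).1 h2
      _ = ∫⁻ _ in B \ C, c ∂μ := by simp
      _ ≤ ∫⁻ x in B \ C, f x ∂μ := setLIntegral_mono' (hB.diff hC) hge
  rw [← measure_inter_add_sdiff C hB, ← measure_inter_add_sdiff B hC, inter_comm B C]
  gcongr

theorem measure_le_of_forall_Ioc_le (D : Set ℝ) (hpos : ∀ t ∈ D, 0 < t)
    (hdown : ∀ t ∈ D, ∀ s, 0 < s → s ≤ t → s ∈ D) {ν : Measure ℝ} {C : ℝ≥0∞}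
    (hν : ∀ t ∈ D, ν (Ioc 0 t) ≤ C) : ν D ≤ C := by
  by_cases hmax : ∃ t ∈ D, ∀ s ∈ D, s ≤ t
  · obtain ⟨t, ht, hs⟩ := hmax
    exact (measure_mono (show D ⊆ Ioc 0 t from fun s h => ⟨hpos s h, hs s h⟩)).trans (hν t ht)
  · push Not at hmax
    have hsub : D ⊆ ⋃ q : {q : ℚ // (q : ℝ) ∈ D}, Ioc (0:ℝ) ((q : ℚ) : ℝ) := by
      intro t ht
      obtain ⟨s, hs, hts⟩ := hmax t ht
      obtain ⟨q, h1, h2⟩ := exists_rat_btwn hts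
      exact mem_iUnion.2 ⟨⟨q, hdown s hs _ ((hpos t ht).trans h1) h2.le⟩, hpos t ht, h1.le⟩
    refine (measure_mono hsub).trans ?_
    have hmono : Monotone fun q : {q : ℚ // (q : ℝ) ∈ D} => Ioc (0:ℝ) ((q : ℚ) : ℝ) :=
      fun a b hab => Ioc_subset_Ioc_right (by exact_mod_cast hab)
    rw [hmono.directed_le.measure_iUnion]
    exact iSup_le fun q => hν _ q.2

namespace BSetup

variable (S : BSetup Ω)

instance : IsProbabilityMeasure S.P := S.isProb

/-- The measure with density `ρ` with respect to `P`. -/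
def priceMeasure : Measure Ω := S.P.withDensity fun ω => ENNReal.ofReal (S.ρ ω)

instance : IsFiniteMeasure S.priceMeasure :=
  isFiniteMeasure_withDensity_ofReal S.ρ_int.2

theorem priceMeasure_absolutelyContinuous : S.priceMeasure ≪ S.P :=
  withDensity_absolutelyContinuous _ _

theorem absolutelyContinuous_priceMeasure : S.P ≪ S.priceMeasure := by
  refine withDensity_absolutelyContinuous' S.meas_ρ.ennreal_ofReal.aemeasurable ?_
  filter_upwards [S.ρ_pos] with ω h
  simpa using h

theorem lintegral_priceMeasure {Y : Ω → ℝ} (hY : Measurable Y) :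
    ∫⁻ ω, ENNReal.ofReal (Y ω) ∂S.priceMeasure = ∫⁻ ω, ENNReal.ofReal (S.ρ ω * Y ω) ∂S.P := by
  rw [priceMeasure, lintegral_withDensity_eq_lintegral_mul _ S.meas_ρ.ennreal_ofReal
    hY.ennreal_ofReal]
  refine lintegral_congr_ae ?_
  filter_upwards [S.ρ_pos] with ω h
  rw [ENNReal.ofReal_mul h.le, Pi.mul_apply]

theorem ae_mul_nonneg {Y : Ω → ℝ} (h0 : ∀ ω, 0 ≤ Y ω) : 0 ≤ᵐ[S.P] fun ω => S.ρ ω * Y ω := by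
  filter_upwards [S.ρ_pos] with ω h using mul_nonneg h.le (h0 ω)

theorem lintegral_priceMeasure_eq_ofReal {Y : Ω → ℝ} (hY : Measurable Y) (h0 : ∀ ω, 0 ≤ Y ω)
    (hi : Integrable (fun ω => S.ρ ω * Y ω) S.P) :
    ∫⁻ ω, ENNReal.ofReal (Y ω) ∂S.priceMeasure = ENNReal.ofReal (∫ ω, S.ρ ω * Y ω ∂S.P) := by
  rw [S.lintegral_priceMeasure hY, ofReal_integral_eq_lintegral_ofReal hi (S.ae_mul_nonneg h0)]

theorem um_max_monotone : Monotone fun x => S.um (max x 0) := fun _ _ h =>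
  S.um_mono.monotoneOn (mem_Ici.2 (le_max_right _ _)) (mem_Ici.2 (le_max_right _ _)) (max_le_max_right _ h)

theorem um_nonneg {x : ℝ} (hx : 0 ≤ x) : 0 ≤ S.um x := by
  have := S.um_mono.monotoneOn (mem_Ici.2 le_rfl) (mem_Ici.2 hx) hx
  rwa [S.um_zero] at this

theorem toReal_mem_Icc (A : Set Ω) : (S.P A).toReal ∈ Icc (0:ℝ) 1 :=
  ⟨ENNReal.toReal_nonneg, measureReal_le_one⟩

theorem Tm_measure_mono {A B : Set Ω} (h : A ⊆ B) :
    S.Tm (S.P A).toReal ≤ S.Tm (S.P B).toReal :=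
  S.Tm_mono.monotoneOn (S.toReal_mem_Icc A) (S.toReal_mem_Icc B)
    (ENNReal.toReal_mono (measure_ne_top _ _) (measure_mono h))

theorem Tp_measure_mono {A B : Set Ω} (h : S.P A ≤ S.P B) :
    S.Tp (S.P A).toReal ≤ S.Tp (S.P B).toReal :=
  S.Tp_mono.monotoneOn (S.toReal_mem_Icc A) (S.toReal_mem_Icc B)
    (ENNReal.toReal_mono (measure_ne_top _ _) h)

theorem Tm_measure_nonneg (A : Set Ω) : 0 ≤ S.Tm (S.P A).toReal := by
  simpa [S.Tm_zero] using S.Tm_measure_mono (empty_subset A)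

/-- The perspective bound: if `∫ l ≤ 1` then `∫₀ᵗ l(s) u₋(1 / l(s)) ds ≤ u₋(t)`. -/
theorem lintegral_perspective_le {l : ℝ → ℝ} (hl : Measurable l) (hl0 : ∀ s, 0 ≤ l s)
    (hl1 : ∫⁻ s in Ioi 0, ENNReal.ofReal (l s) ≤ 1) {t : ℝ} (ht : 0 < t) :
    ∫⁻ s in Ioc 0 t, ENNReal.ofReal (l s * S.um (max (1 / l s) 0)) ≤ ENNReal.ofReal (S.um t) := by
  obtain ⟨k, hk⟩ := S.um_concave.exists_supergradient ht
  have hk0 : 0 ≤ k := by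
    have h1 := hk (t + 1) (by linarith)
    have h2 := S.um_mono (mem_Ici.2 ht.le) (mem_Ici.2 (by linarith : (0:ℝ) ≤ t + 1)) (by linarith)
    linarith
  have hb : 0 ≤ S.um t - k * t := by
    have h1 := hk 0 le_rfl
    rw [S.um_zero] at h1
    linarith
  calc ∫⁻ s in Ioc 0 t, ENNReal.ofReal (l s * S.um (max (1 / l s) 0))
      ≤ ∫⁻ s in Ioc 0 t, (ENNReal.ofReal (S.um t - k * t) * ENNReal.ofReal (l s)
          + ENNReal.ofReal k) := by
        refine lintegral_mono fun s => ?_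
        rw [← ENNReal.ofReal_mul hb, ← ENNReal.ofReal_add (mul_nonneg hb (hl0 s)) hk0]
        refine ENNReal.ofReal_le_ofReal ?_
        rcases (hl0 s).eq_or_lt with h | h
        · rw [← h]
          simpa using hk0
        · have h1 := hk (1 / l s) (by positivity)
          rw [max_eq_left (by positivity)]
          have h2 := mul_le_mul_of_nonneg_left h1 h.le
          have h3 : l s * (1 / l s) = 1 := by field_simp
          nlinarith
    _ = ENNReal.ofReal (S.um t - k * t) * (∫⁻ s in Ioc 0 t, ENNReal.ofReal (l s))
          + ENNReal.ofReal k * ENNReal.ofReal t := by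
        rw [lintegral_add_right _ measurable_const, lintegral_const_mul _ hl.ennreal_ofReal]
        simp
    _ ≤ ENNReal.ofReal (S.um t - k * t) * 1 + ENNReal.ofReal k * ENNReal.ofReal t := by
        gcongr
        exact (lintegral_mono_set Ioc_subset_Ioi_self).trans hl1
    _ = ENNReal.ofReal (S.um t) := by
        rw [mul_one, ← ENNReal.ofReal_mul hk0, ← ENNReal.ofReal_add hb (by positivity)]
        congr 1
        ring

/-- A lower bound for `V₋(Z)` by the values of `V₋` at two-valued random variables. -/
theorem ofReal_le_Vmn {Z : Ω → ℝ} (hZ : Measurable Z) (h0 : ∀ ω, 0 ≤ Z ω) {a m : ℝ}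
    (ha : 0 < a) (hZa : ∫⁻ ω, ENNReal.ofReal (Z ω) ∂S.priceMeasure = ENNReal.ofReal a)
    (h : ∀ t, 0 < t → S.priceMeasure {ω | t < Z ω} ≠ 0 →
      m ≤ S.um (a / (S.priceMeasure {ω | t < Z ω}).toReal) * S.Tm (S.P {ω | t < Z ω}).toReal) :
    ENNReal.ofReal m ≤ Vmn S Z := by
  set w : ℝ → ℝ≥0∞ := fun t => S.priceMeasure {ω | t < Z ω} with hw
  set l : ℝ → ℝ := fun t => (w t).toReal / a with hl
  set k : ℝ → ℝ≥0∞ := fun t => ENNReal.ofReal (l t * S.um (max (1 / l t) 0)) with hk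
  set q : ℝ → ℝ := fun t => S.Tm (S.P {ω | t < Z ω}).toReal with hq
  set Q : ℝ → ℝ := fun y => S.Tm (S.P {ω | y < S.um (Z ω)}).toReal with hQ
  have hl_anti : Antitone l := fun s t hst => by
    refine div_le_div_of_nonneg_right ?_ ha.le
    exact ENNReal.toReal_mono (measure_ne_top _ _)
      (measure_mono fun ω (hω : t < Z ω) => hst.trans_lt hω)
  have hl0 : ∀ t, 0 ≤ l t := fun t => by positivity
  have hk_meas : Measurable k :=
    (hl_anti.measurable.mul (S.um_max_monotone.measurable.comp
      (measurable_const.div hl_anti.measurable))).ennreal_ofReal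
  have hq_anti : Antitone q := fun s t hst =>
    S.Tm_measure_mono fun ω (hω : t < Z ω) => hst.trans_lt hω
  have hQ_anti : Antitone Q := fun s t hst =>
    S.Tm_measure_mono fun ω (hω : t < S.um (Z ω)) => hst.trans_lt hω
  have hl1 : ∫⁻ t in Ioi 0, ENNReal.ofReal (l t) = 1 := by
    have h1 : ∫⁻ t in Ioi 0, w t = ENNReal.ofReal a := by
      rw [← hZa, lintegral_eq_lintegral_meas_lt _ (ae_of_all _ h0) hZ.aemeasurable]
    have h2 : ∀ t, ENNReal.ofReal (l t) = w t * (ENNReal.ofReal a)⁻¹ := fun t => by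
      rw [hl, ENNReal.ofReal_div_of_pos ha, ENNReal.ofReal_toReal (measure_ne_top _ _),
        div_eq_mul_inv]
    simp_rw [h2]
    rw [lintegral_mul_const' _ _ (by simpa using ha), h1,
      ENNReal.mul_inv_cancel (by simpa using ha) ENNReal.ofReal_ne_top]
  have hmem : ∀ r : ℝ, ((volume.restrict (Ioi 0)).withDensity k) {t | r < q t}
      ≤ (volume.restrict (Ioi 0)) {y | r < Q y} := by
    intro r
    have hm1 : MeasurableSet {t | r < q t} := measurableSet_lt measurable_const hq_anti.measurable
    have hm2 : MeasurableSet {t | r < Q t} := measurableSet_lt measurable_const hQ_anti.measurable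
    rw [← restrict_withDensity measurableSet_Ioi, Measure.restrict_apply hm1,
      Measure.restrict_apply hm2]
    refine measure_le_of_forall_Ioc_le ({t | r < q t} ∩ Ioi 0) (fun t ht => ht.2)
      (fun t ht s hs hst => ⟨lt_of_lt_of_le ht.1 (hq_anti hst), hs⟩) fun t ht => ?_
    rw [withDensity_apply _ measurableSet_Ioc]
    refine (S.lintegral_perspective_le hl_anti.measurable hl0 hl1.le ht.2).trans ?_
    have h1 : Ioo 0 (S.um t) ⊆ {y | r < Q y} ∩ Ioi 0 := fun y hy => by
      have h2 : {ω | t < Z ω} ⊆ {ω | y < S.um (Z ω)} := fun ω (hω : t < Z ω) =>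
        hy.2.trans (S.um_mono (mem_Ici.2 (le_of_lt ht.2)) (mem_Ici.2 (h0 ω)) hω)
      exact ⟨lt_of_lt_of_le ht.1 (S.Tm_measure_mono h2), hy.1⟩
    calc ENNReal.ofReal (S.um t) = volume (Ioo 0 (S.um t)) := by simp
      _ ≤ _ := measure_mono h1
  calc ENNReal.ofReal m = ∫⁻ t in Ioi 0, ENNReal.ofReal (l t) * ENNReal.ofReal m := by
        rw [lintegral_mul_const' _ _ ENNReal.ofReal_ne_top, hl1, one_mul]
    _ ≤ ∫⁻ t in Ioi 0, k t * ENNReal.ofReal (q t) := by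
        refine setLIntegral_mono' measurableSet_Ioi fun t ht => ?_
        by_cases hwt : w t = 0
        · simp [hl, hwt]
        · have hwp : 0 < (w t).toReal := ENNReal.toReal_pos hwt (measure_ne_top _ _)
          have hlt : 0 < l t := div_pos hwp ha
          have h1 : max (1 / l t) 0 = a / (w t).toReal := by
            rw [max_eq_left (by positivity), hl, one_div_div]
          simp only [hk]
          rw [h1, ← ENNReal.ofReal_mul hlt.le, ← ENNReal.ofReal_mul
            (mul_nonneg hlt.le (S.um_nonneg (by positivity))), mul_assoc]
          exact ENNReal.ofReal_le_ofReal (mul_le_mul_of_nonneg_left (h t ht hwt) hlt.le)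
    _ = ∫⁻ t, ENNReal.ofReal (q t) ∂((volume.restrict (Ioi 0)).withDensity k) := by
        rw [lintegral_withDensity_eq_lintegral_mul _ hk_meas hq_anti.measurable.ennreal_ofReal]
        rfl
    _ = ∫⁻ r in Ioi 0, ((volume.restrict (Ioi 0)).withDensity k) {t | r < q t} :=
        lintegral_eq_lintegral_meas_lt _ (ae_of_all _ fun t => S.Tm_measure_nonneg _)
          hq_anti.measurable.aemeasurable
    _ ≤ ∫⁻ r in Ioi 0, (volume.restrict (Ioi 0)) {y | r < Q y} := lintegral_mono hmem
    _ = Vmn S Z := (lintegral_eq_lintegral_meas_lt _ (ae_of_all _ fun t => S.Tm_measure_nonneg _)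
          hQ_anti.measurable.aemeasurable).symm

theorem integrable_of_lintegral_priceMeasure {Y : Ω → ℝ} (hY : Measurable Y) (h0 : ∀ ω, 0 ≤ Y ω)
    {x : ℝ} (hx : 0 ≤ x) (h : ∫⁻ ω, ENNReal.ofReal (Y ω) ∂S.priceMeasure = ENNReal.ofReal x) :
    Integrable (fun ω => S.ρ ω * Y ω) S.P ∧ ∫ ω, S.ρ ω * Y ω ∂S.P = x := by
  have hm : AEStronglyMeasurable (fun ω => S.ρ ω * Y ω) S.P :=
    (S.meas_ρ.mul hY).aestronglyMeasurable
  rw [S.lintegral_priceMeasure hY] at h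
  refine ⟨⟨hm, ?_⟩, ?_⟩
  · rw [hasFiniteIntegral_iff_ofReal (S.ae_mul_nonneg h0), h]
    exact ENNReal.ofReal_lt_top
  · rw [integral_eq_lintegral_of_nonneg_ae (S.ae_mul_nonneg h0) hm, h, ENNReal.toReal_ofReal hx]

theorem Fdist_monotone : Monotone (Fdist S) := fun _ _ h =>
  ENNReal.toReal_mono (measure_ne_top _ _) (measure_mono fun _ (hω : S.ρ _ ≤ _) => hω.trans h)

theorem cdf_map_eq_Fdist (x : ℝ) : ProbabilityTheory.cdf (S.P.map S.ρ) x = Fdist S x := by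
  have := Measure.isProbabilityMeasure_map (μ := S.P) S.meas_ρ.aemeasurable
  rw [ProbabilityTheory.cdf_eq_real, measureReal_def, Measure.map_apply S.meas_ρ measurableSet_Iic]
  rfl

theorem Fdist_continuous : Continuous (Fdist S) := by
  have := Measure.isProbabilityMeasure_map (μ := S.P) S.meas_ρ.aemeasurable
  set G := ProbabilityTheory.cdf (S.P.map S.ρ) with hG
  have hFG : Fdist S = G := funext fun x => (S.cdf_map_eq_Fdist x).symm
  rw [hFG, continuous_iff_continuousAt]
  intro a
  refine continuousAt_iff_continuous_left'_right'.2 ⟨?_, ?_⟩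
  · rw [G.mono.continuousWithinAt_Iio_iff_leftLim_eq]
    have h1 := G.measure_singleton a
    rw [hG, ProbabilityTheory.measure_cdf, Measure.map_apply S.meas_ρ (measurableSet_singleton a),
      show S.ρ ⁻¹' {a} = {ω | S.ρ ω = a} from rfl, S.ρ_atomless a, ← hG] at h1
    have h2 := ENNReal.ofReal_eq_zero.1 h1.symm
    exact le_antisymm (G.mono.leftLim_le le_rfl) (by linarith)
  · exact (G.right_continuous a).mono Ioi_subset_Ici_self

theorem exists_Fdist_eq {v : ℝ} (h0 : 0 < v) (h1 : v < 1) : ∃ d, Fdist S d = v := by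
  have := Measure.isProbabilityMeasure_map (μ := S.P) S.meas_ρ.aemeasurable
  have hb := ProbabilityTheory.tendsto_cdf_atBot (S.P.map S.ρ)
  have ht := ProbabilityTheory.tendsto_cdf_atTop (S.P.map S.ρ)
  obtain ⟨a, ha⟩ := (hb.eventually (gt_mem_nhds h0)).exists
  obtain ⟨b, hb⟩ := (ht.eventually (lt_mem_nhds h1)).exists
  rw [cdf_map_eq_Fdist] at ha hb
  exact mem_range_of_exists_le_of_exists_ge S.Fdist_continuous ⟨a, ha.le⟩ ⟨b, hb.le⟩

/-- The probability integral transform. -/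
theorem measure_Fdist_lt {v : ℝ} (h0 : 0 ≤ v) (h1 : v ≤ 1) :
    (S.P {ω | Fdist S (S.ρ ω) < v}).toReal = v := by
  apply le_antisymm
  · rcases h0.eq_or_lt with rfl | h0
    · have : {ω | Fdist S (S.ρ ω) < 0} = ∅ := by
        ext ω
        simp [Fdist]
      simp [this]
    rcases h1.eq_or_lt with rfl | h1
    · exact (S.toReal_mem_Icc _).2
    obtain ⟨d, hd⟩ := S.exists_Fdist_eq h0 h1
    conv_rhs => rw [← hd]
    refine ENNReal.toReal_mono (measure_ne_top _ _) (measure_mono fun ω hω => ?_)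
    by_contra hlt
    have := S.Fdist_monotone (not_le.1 hlt).le
    simp only [mem_ofPred_eq] at hω
    linarith
  · rcases h0.eq_or_lt with rfl | h0
    · exact ENNReal.toReal_nonneg
    refine le_of_forall_lt fun c hc => ?_
    obtain ⟨v', h2, h3⟩ := exists_between (max_lt hc h0)
    obtain ⟨d, hd⟩ := S.exists_Fdist_eq ((le_max_right _ _).trans_lt h2) (h3.trans_le h1)
    refine ((le_max_left _ _).trans_lt h2).trans_le ?_
    rw [← hd]
    refine ENNReal.toReal_mono (measure_ne_top _ _) (measure_mono fun ω hω => ?_)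
    exact (S.Fdist_monotone hω).trans_lt (hd ▸ h3)

theorem ae_Fdist_pos : ∀ᵐ ω ∂S.P, 0 < Fdist S (S.ρ ω) := by
  rw [ae_iff]
  refine (ENNReal.toReal_eq_zero_iff _).1 (le_antisymm ?_ ENNReal.toReal_nonneg) |>.resolve_right
    (measure_ne_top _ _)
  refine le_of_forall_pos_lt_add fun e he => ?_
  rw [zero_add]
  have he' : 0 < min (e / 2) 1 := by positivity
  refine lt_of_le_of_lt ?_ (show min (e / 2) 1 < e from (min_le_left _ _).trans_lt (by linarith))
  conv_rhs => rw [← S.measure_Fdist_lt he'.le (min_le_right _ _)]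
  exact ENNReal.toReal_mono (measure_ne_top _ _)
    (measure_mono fun ω hω => (not_lt.1 hω).trans_lt he')

theorem priceMeasure_le_of_measure_eq {B : Set Ω} (hB : MeasurableSet B) {d : ℝ}
    (h : S.P {ω | S.ρ ω ≤ d} = S.P B) : S.priceMeasure {ω | S.ρ ω ≤ d} ≤ S.priceMeasure B :=
  withDensity_le_of_measure_eq hB (measurableSet_le S.meas_ρ measurable_const) h
    (ENNReal.ofReal d) (fun _ hω => ENNReal.ofReal_le_ofReal hω.1)
    (fun _ hω => ENNReal.ofReal_le_ofReal (not_le.1 hω.2).le)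

theorem priceMeasure_ge_of_measure_eq {B : Set Ω} (hB : MeasurableSet B) {d : ℝ}
    (h : S.P {ω | d < S.ρ ω} = S.P B) : S.priceMeasure B ≤ S.priceMeasure {ω | d < S.ρ ω} :=
  withDensity_le_of_measure_eq (measurableSet_lt measurable_const S.meas_ρ) hB h.symm
    (ENNReal.ofReal d) (fun _ hω => ENNReal.ofReal_le_ofReal (not_lt.1 hω.2))
    (fun _ hω => ENNReal.ofReal_le_ofReal (le_of_lt hω.1))

/-- The generalized inverse of the tail function of `Y`, set to zero off `(0,∞)`. -/
def tailInv (Y : Ω → ℝ) (v : ℝ) : ℝ :=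
  if 0 < v then sSup {s | 0 ≤ s ∧ v < (S.P {ω | s < Y ω}).toReal} else 0

theorem lt_tailInv_iff {Y : Ω → ℝ} (hY : Measurable Y) {s v : ℝ} (hs : 0 ≤ s) :
    s < S.tailInv Y v ↔ 0 < v ∧ v < (S.P {ω | s < Y ω}).toReal := by
  by_cases hv : 0 < v
  swap
  · simp [tailInv, hv, hs]
  rw [tailInv, if_pos hv]
  have hanti : ∀ {a b : ℝ}, a ≤ b →
      (S.P {ω | b < Y ω}).toReal ≤ (S.P {ω | a < Y ω}).toReal := fun hab =>
    ENNReal.toReal_mono (measure_ne_top _ _)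
      (measure_mono fun ω (hω : _ < Y ω) => hab.trans_lt hω)
  refine ⟨fun h => ⟨hv, ?_⟩, fun h => ?_⟩
  · have hne : {s | 0 ≤ s ∧ v < (S.P {ω | s < Y ω}).toReal}.Nonempty := by
      by_contra hne
      rw [not_nonempty_iff_eq_empty.1 hne, Real.sSup_empty] at h
      linarith
    obtain ⟨s', h1, h2⟩ := exists_lt_of_lt_csSup hne h
    exact h1.2.trans_le (hanti h2.le)
  · have hbdd : BddAbove {s | 0 ≤ s ∧ v < (S.P {ω | s < Y ω}).toReal} := by
      have h1 : Tendsto (fun n : ℕ => S.P {ω | (n : ℝ) < Y ω}) atTop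
          (nhds (S.P (⋂ n : ℕ, {ω | (n : ℝ) < Y ω}))) :=
        tendsto_measure_iInter_atTop
          (fun n => (measurableSet_lt measurable_const hY).nullMeasurableSet)
          (fun a b hab ω (hω : (b : ℝ) < Y ω) => show (a : ℝ) < Y ω from
            lt_of_le_of_lt (by exact_mod_cast hab) hω)
          ⟨0, measure_ne_top _ _⟩
      have h2 : ⋂ n : ℕ, {ω | (n : ℝ) < Y ω} = ∅ := by
        ext ω
        simp only [mem_iInter, mem_ofPred_eq, mem_empty_iff_false, iff_false, not_forall, not_lt]
        exact exists_nat_ge _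
      rw [h2, measure_empty] at h1
      have h3 := (ENNReal.tendsto_toReal ENNReal.zero_ne_top).comp h1
      obtain ⟨n, hn⟩ := (h3.eventually (gt_mem_nhds hv)).exists
      refine ⟨n, fun s hs => ?_⟩
      by_contra hlt
      exact absurd (hs.2.trans_le (hanti (not_le.1 hlt).le)) (not_lt.2 (le_of_lt hn))
    have h1 : Tendsto (fun n : ℕ => S.P {ω | s + 1 / ((n : ℝ) + 1) < Y ω}) atTop
        (nhds (S.P (⋃ n : ℕ, {ω | s + 1 / ((n : ℝ) + 1) < Y ω}))) :=
      tendsto_measure_iUnion_atTop fun a b hab ω (hω : _ < Y ω) => show _ < Y ω from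
        lt_of_le_of_lt (by gcongr) hω
    have h2 : ⋃ n : ℕ, {ω | s + 1 / ((n : ℝ) + 1) < Y ω} = {ω | s < Y ω} := by
      ext ω
      simp only [mem_iUnion, mem_ofPred_eq]
      refine ⟨fun ⟨n, hn⟩ => lt_trans (lt_add_of_pos_right _ (by positivity)) hn, fun hω => ?_⟩
      obtain ⟨n, hn⟩ := exists_nat_one_div_lt (sub_pos.2 hω)
      exact ⟨n, by linarith⟩
    rw [h2] at h1
    have h3 := (ENNReal.tendsto_toReal (measure_ne_top _ _)).comp h1
    obtain ⟨n, hn⟩ := (h3.eventually (lt_mem_nhds h.2)).exists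
    have hn' : (0:ℝ) < 1 / ((n : ℝ) + 1) := by positivity
    exact (lt_add_of_pos_right s hn').trans_le (le_csSup hbdd ⟨by linarith, hn⟩)

theorem tailInv_nonneg (Y : Ω → ℝ) (v : ℝ) : 0 ≤ S.tailInv Y v := by
  rw [tailInv]
  split_ifs
  · exact Real.sSup_nonneg fun s hs => hs.1
  · exact le_rfl

theorem tailInv_measurable {Y : Ω → ℝ} (hY : Measurable Y) : Measurable (S.tailInv Y) := by
  refine measurable_of_Ioi fun s => ?_
  rcases lt_or_ge s 0 with hs | hs
  · convert MeasurableSet.univ using 1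
    exact eq_univ_of_forall fun v => hs.trans_le (S.tailInv_nonneg Y v)
  · convert measurableSet_Ioo (a := (0:ℝ)) (b := (S.P {ω | s < Y ω}).toReal) using 1
    ext v
    exact S.lt_tailInv_iff hY hs

/-- The rearrangement of `Y` that is anti-comonotonic with `ρ`. -/
def rearrange (Y : Ω → ℝ) (ω : Ω) : ℝ := S.tailInv Y (Fdist S (S.ρ ω))

theorem rearrange_nonneg (Y : Ω → ℝ) (ω : Ω) : 0 ≤ S.rearrange Y ω := S.tailInv_nonneg _ _

theorem rearrange_measurable {Y : Ω → ℝ} (hY : Measurable Y) : Measurable (S.rearrange Y) :=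
  (S.tailInv_measurable hY).comp (S.Fdist_continuous.measurable.comp S.meas_ρ)

theorem measure_lt_rearrange {Y : Ω → ℝ} (hY : Measurable Y) {s : ℝ} (hs : 0 ≤ s) :
    S.P {ω | s < S.rearrange Y ω} = S.P {ω | s < Y ω} := by
  rw [← ENNReal.toReal_eq_toReal_iff' (measure_ne_top _ _) (measure_ne_top _ _)]
  have hv := S.toReal_mem_Icc {ω | s < Y ω}
  conv_rhs => rw [← S.measure_Fdist_lt hv.1 hv.2]
  congr 1
  refine measure_congr ?_
  filter_upwards [S.ae_Fdist_pos] with ω hω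
  exact propext ((S.lt_tailInv_iff hY hs).trans (and_iff_right hω))

theorem priceMeasure_lt_rearrange_le {Y : Ω → ℝ} (hY : Measurable Y) {s : ℝ} (hs : 0 ≤ s) :
    S.priceMeasure {ω | s < S.rearrange Y ω} ≤ S.priceMeasure {ω | s < Y ω} := by
  have hB : MeasurableSet {ω | s < Y ω} := measurableSet_lt measurable_const hY
  have hv := S.toReal_mem_Icc {ω | s < Y ω}
  have hsub : ∀ ω, s < S.rearrange Y ω → Fdist S (S.ρ ω) < (S.P {ω | s < Y ω}).toReal :=
    fun ω hω => ((S.lt_tailInv_iff hY hs).1 hω).2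
  rcases hv.1.eq_or_lt with h0 | h0
  · have : {ω | s < S.rearrange Y ω} = ∅ := by
      ext ω
      simp only [mem_ofPred_eq, mem_empty_iff_false, iff_false]
      intro hω
      have h1 := hsub ω hω
      rw [← h0] at h1
      exact absurd h1 (not_lt.2 ENNReal.toReal_nonneg)
    simp [this]
  rcases hv.2.eq_or_lt with h1 | h1
  · have h2 : S.P {ω | s < Y ω} = 1 := by
      rw [← ENNReal.ofReal_toReal (measure_ne_top S.P _), h1, ENNReal.ofReal_one]
    have h3 : S.P {ω | s < Y ω}ᶜ = 0 := (prob_compl_eq_zero_iff hB).2 h2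
    have h4 := S.priceMeasure_absolutelyContinuous h3
    refine (measure_mono (subset_univ _)).trans ?_
    rw [← measure_add_measure_compl hB, h4, add_zero]
  obtain ⟨d, hd⟩ := S.exists_Fdist_eq h0 h1
  refine (measure_mono fun ω hω => ?_).trans (S.priceMeasure_le_of_measure_eq hB (d := d)
    ((ENNReal.toReal_eq_toReal_iff' (measure_ne_top _ _) (measure_ne_top _ _)).1 hd))
  by_contra hlt
  have h2 := hsub ω hω
  have h3 := S.Fdist_monotone (not_le.1 hlt).le
  linarith

theorem lintegral_rearrange_le {Y : Ω → ℝ} (hY : Measurable Y) (h0 : ∀ ω, 0 ≤ Y ω) :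
    ∫⁻ ω, ENNReal.ofReal (S.rearrange Y ω) ∂S.priceMeasure
      ≤ ∫⁻ ω, ENNReal.ofReal (Y ω) ∂S.priceMeasure := by
  rw [lintegral_eq_lintegral_meas_lt _ (ae_of_all _ h0) hY.aemeasurable,
    lintegral_eq_lintegral_meas_lt _ (ae_of_all _ fun ω => S.rearrange_nonneg _ _)
      (S.rearrange_measurable hY).aemeasurable]
  exact setLIntegral_mono' measurableSet_Ioi fun s hs =>
    S.priceMeasure_lt_rearrange_le hY (le_of_lt hs)

theorem rearrange_eq_zero {Y : Ω → ℝ} (hY : Measurable Y) {c : ℝ}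
    (hc : S.P {ω | 0 < Y ω} ≤ S.P {ω | S.ρ ω ≤ c}) {ω : Ω} (hω : c < S.ρ ω) :
    S.rearrange Y ω = 0 := by
  refine le_antisymm (not_lt.1 fun h => ?_) (S.rearrange_nonneg _ _)
  have h1 := ((S.lt_tailInv_iff hY le_rfl).1 h).2
  have h2 : (S.P {ω | 0 < Y ω}).toReal ≤ Fdist S c := ENNReal.toReal_mono (measure_ne_top _ _) hc
  have h3 := S.Fdist_monotone hω.le
  linarith

theorem Vpl_le_rearrange {Y : Ω → ℝ} (hY : Measurable Y) (h0 : ∀ ω, 0 ≤ Y ω) {Z : Ω → ℝ}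
    (hZ : ∀ ω, S.rearrange Y ω ≤ Z ω) : Vpl S Y ≤ Vpl S Z := by
  have hR := S.rearrange_measurable hY
  have htail : ∀ a : ℝ, S.P {ω | a < S.rearrange Y ω} = S.P {ω | a < Y ω} := by
    intro a
    rcases lt_or_ge a 0 with ha | ha
    · rw [eq_univ_of_forall fun ω => show ω ∈ {ω | a < S.rearrange Y ω} from
        ha.trans_le (S.rearrange_nonneg _ _),
        eq_univ_of_forall fun ω => show ω ∈ {ω | a < Y ω} from ha.trans_le (h0 ω)]
    · exact S.measure_lt_rearrange hY ha
  have hmap : S.P.map (S.rearrange Y) = S.P.map Y := by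
    have := Measure.isProbabilityMeasure_map (μ := S.P) hR.aemeasurable
    refine Measure.ext_of_Iic _ _ fun a => ?_
    rw [Measure.map_apply hR measurableSet_Iic, Measure.map_apply hY measurableSet_Iic]
    have h1 : S.rearrange Y ⁻¹' Iic a = {ω | a < S.rearrange Y ω}ᶜ := by ext; simp
    have h2 : Y ⁻¹' Iic a = {ω | a < Y ω}ᶜ := by ext; simp
    rw [h1, h2, prob_compl_eq_one_sub (measurableSet_lt measurable_const hR),
      prob_compl_eq_one_sub (measurableSet_lt measurable_const hY), htail]
  refine lintegral_mono fun y => ENNReal.ofReal_le_ofReal (S.Tp_measure_mono ?_)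
  have hmono : Monotone fun x => S.up (max x 0) := fun _ _ h =>
    S.up_mono.monotoneOn (mem_Ici.2 (le_max_right _ _)) (mem_Ici.2 (le_max_right _ _))
      (max_le_max_right _ h)
  have hms : MeasurableSet {x : ℝ | y < S.up (max x 0)} :=
    measurableSet_lt measurable_const hmono.measurable
  have h1 : {ω | y < S.up (Y ω)} = Y ⁻¹' {x : ℝ | y < S.up (max x 0)} := by
    ext ω
    simp [max_eq_left (h0 ω)]
  rw [h1, ← Measure.map_apply hY hms, ← hmap, Measure.map_apply hR hms]
  refine measure_mono fun ω (hω : y < S.up (max (S.rearrange Y ω) 0)) => ?_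
  have h2 : 0 ≤ S.rearrange Y ω := S.rearrange_nonneg _ _
  rw [max_eq_left h2] at hω
  exact hω.trans_le (S.up_mono.monotoneOn (mem_Ici.2 h2) (mem_Ici.2 (h2.trans (hZ ω))) (hZ ω))

/-- The positive part of a payoff is dominated, at equal cost, by a payoff supported on
`{ρ ≤ c}`, provided that this event is at least as likely as `{Y > 0}`. -/
theorem Vpl_le_vPos_lev {Y : Ω → ℝ} (hY : Measurable Y) (h0 : ∀ ω, 0 ≤ Y ω)
    (hi : Integrable (fun ω => S.ρ ω * Y ω) S.P) {c : ℝ} (hc0 : S.P {ω | S.ρ ω ≤ c} ≠ 0)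
    (hc : S.P {ω | 0 < Y ω} ≤ S.P {ω | S.ρ ω ≤ c}) :
    (Vpl S Y : EReal) ≤ vPos S (lev S c) (∫ ω, S.ρ ω * Y ω ∂S.P) := by
  set x := ∫ ω, S.ρ ω * Y ω ∂S.P with hx
  have hx0 : 0 ≤ x := integral_nonneg_of_ae (S.ae_mul_nonneg h0)
  have hlev : lev S c = {ω | S.ρ ω ≤ c} := by
    ext ω
    simp [lev]
  set C := {ω | S.ρ ω ≤ c} with hC
  have hCm : MeasurableSet C := measurableSet_le S.meas_ρ measurable_const
  have hνC : 0 < (S.priceMeasure C).toReal :=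
    ENNReal.toReal_pos (fun h => hc0 (S.absolutelyContinuous_priceMeasure h)) (measure_ne_top _ _)
  have hR := S.rearrange_measurable hY
  have hR0 : ∀ ω, 0 ≤ S.rearrange Y ω := fun ω => S.rearrange_nonneg _ _
  have hle := S.lintegral_rearrange_le hY h0
  rw [S.lintegral_priceMeasure_eq_ofReal hY h0 hi] at hle
  set e := (∫⁻ ω, ENNReal.ofReal (S.rearrange Y ω) ∂S.priceMeasure).toReal with he
  have hfin : ∫⁻ ω, ENNReal.ofReal (S.rearrange Y ω) ∂S.priceMeasure = ENNReal.ofReal e :=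
    (ENNReal.ofReal_toReal (ne_top_of_le_ne_top ENNReal.ofReal_ne_top hle)).symm
  rw [hfin] at hle
  have hex : e ≤ x := (ENNReal.ofReal_le_ofReal_iff hx0).1 hle
  set k := (x - e) / (S.priceMeasure C).toReal with hk
  have hk0 : 0 ≤ k := div_nonneg (by linarith) hνC.le
  set Z : Ω → ℝ := fun ω => S.rearrange Y ω + C.indicator (fun _ => k) ω with hZ
  have hi0 : ∀ ω, 0 ≤ C.indicator (fun _ => k) ω := fun ω => indicator_nonneg (fun _ _ => hk0) ω
  have hZm : Measurable Z := hR.add (measurable_const.indicator hCm)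
  have hZ0 : ∀ ω, 0 ≤ Z ω := fun ω => add_nonneg (hR0 ω) (hi0 ω)
  have hZx : ∫⁻ ω, ENNReal.ofReal (Z ω) ∂S.priceMeasure = ENNReal.ofReal x := by
    have h1 : ∀ ω, ENNReal.ofReal (Z ω) = ENNReal.ofReal (S.rearrange Y ω) +
        C.indicator (fun _ => ENNReal.ofReal k) ω := fun ω => by
      rw [hZ, ENNReal.ofReal_add (hR0 ω) (hi0 ω)]
      by_cases h : ω ∈ C <;> simp [h]
    simp_rw [h1]
    rw [lintegral_add_left hR.ennreal_ofReal, lintegral_indicator_const hCm, hfin,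
      ← ENNReal.ofReal_toReal (measure_ne_top S.priceMeasure C), ← ENNReal.ofReal_mul hk0,
      ← ENNReal.ofReal_add ENNReal.toReal_nonneg (by positivity)]
    congr 1
    rw [hk]
    field_simp
    ring
  obtain ⟨hZi, hZe⟩ := S.integrable_of_lintegral_priceMeasure hZm hZ0 hx0 hZx
  have hfeas : FeasPos S C x Z := by
    refine ⟨hZm.aemeasurable, ae_of_all _ hZ0, hZi, hZe, ae_of_all _ fun ω hω => ?_⟩
    rw [hZ]
    simp only
    rw [indicator_of_notMem hω, S.rearrange_eq_zero hY hc (not_le.1 hω), add_zero]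
  rw [hlev, vPos, if_neg hc0]
  refine le_trans ?_ (le_sSup ⟨Z, hfeas, rfl⟩)
  exact EReal.coe_ennreal_le_coe_ennreal_iff.2
    (S.Vpl_le_rearrange hY h0 fun ω => le_add_of_nonneg_right (hi0 ω))

theorem Vpl_congr_ae {Y Z : Ω → ℝ} (h : Y =ᵐ[S.P] Z) : Vpl S Y = Vpl S Z := by
  refine lintegral_congr fun y => ?_
  congr 3
  refine measure_congr ?_
  filter_upwards [h] with ω hω
  exact propext (by simp [Set.ofPred, hω])

theorem Vmn_congr_ae {Y Z : Ω → ℝ} (h : Y =ᵐ[S.P] Z) : Vmn S Y = Vmn S Z := by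
  refine lintegral_congr fun y => ?_
  congr 3
  refine measure_congr ?_
  filter_upwards [h] with ω hω
  exact propext (by simp [Set.ofPred, hω])

theorem Vval_congr_ae {X Y : Ω → ℝ} (h : X =ᵐ[S.P] Y) : Vval S X = Vval S Y := by
  rw [Vval, Vval, S.Vpl_congr_ae (Z := fun ω => max (Y ω) 0) (h.mono fun ω hω => by simp [hω]),
    S.Vmn_congr_ae (Z := fun ω => max (-Y ω) 0) (h.mono fun ω hω => by simp [hω])]

theorem Vpl_eq_zero {Y : Ω → ℝ} (h : ∀ᵐ ω ∂S.P, Y ω = 0) : Vpl S Y = 0 := by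
  rw [S.Vpl_congr_ae (Z := fun _ => 0) h, Vpl, setLIntegral_congr_fun (g := fun _ => 0)
    measurableSet_Ioi]
  · simp
  · intro y (hy : 0 < y)
    simp [S.up_zero, not_lt.2 hy.le, S.Tp_zero]

theorem measurable_ereal : Measurable fun ω => (S.ρ ω : EReal) :=
  measurable_coe_real_ereal.comp S.meas_ρ

theorem measurableSet_lev (c : EReal) : MeasurableSet (lev S c) :=
  measurableSet_le S.measurable_ereal measurable_const

theorem compl_lev (c : EReal) : (lev S c)ᶜ = {ω | c < (S.ρ ω : EReal)} := by
  ext ω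
  simp [lev]

theorem lev_mono {c d : EReal} (h : c ≤ d) : lev S c ⊆ lev S d := fun _ hω => le_trans hω h

theorem ae_le_rhoBar : ∀ᵐ ω ∂S.P, (S.ρ ω : EReal) ≤ rhoBar S := ae_le_essSup

theorem measure_lev_rhoLow : S.P (lev S (rhoLow S)) = 0 := by
  have h1 : ∀ᵐ ω ∂S.P, rhoLow S ≤ (S.ρ ω : EReal) := ae_essInf_le
  have h2 : ∀ᵐ ω ∂S.P, (S.ρ ω : EReal) ≠ rhoLow S := by
    generalize rhoLow S = z
    induction z with
    | bot => exact ae_of_all _ fun ω => EReal.coe_ne_bot _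
    | top => exact ae_of_all _ fun ω => EReal.coe_ne_top _
    | coe a =>
      rw [ae_iff]
      simpa using S.ρ_atomless a
  have h3 : ∀ᵐ ω ∂S.P, ω ∉ lev S (rhoLow S) := by
    filter_upwards [h1, h2] with ω h4 h5 h6
    exact h5 (le_antisymm h6 h4)
  simpa [ae_iff] using h3

theorem measure_lev_rhoBar : S.P (lev S (rhoBar S)) = 1 :=
  (prob_compl_eq_zero_iff (S.measurableSet_lev _)).1 S.ae_le_rhoBar

theorem rhoLow_lt {c : EReal} (hc : S.P (lev S c) ≠ 0) : rhoLow S < c := by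
  by_contra h
  exact hc (measure_mono_null (S.lev_mono (not_lt.1 h)) S.measure_lev_rhoLow)

theorem lt_rhoBar {c : EReal} (hc : S.P (lev S c) ≠ 1) : c < rhoBar S := by
  by_contra h
  refine hc (le_antisymm prob_le_one ?_)
  rw [← S.measure_lev_rhoBar]
  exact measure_mono (S.lev_mono (not_lt.1 h))

theorem ERhoGt_eq (c : EReal) :
    ERhoGt S c = (S.priceMeasure {ω | c < (S.ρ ω : EReal)}).toReal := by
  have hm : MeasurableSet {ω | c < (S.ρ ω : EReal)} :=
    measurableSet_lt measurable_const S.measurable_ereal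
  have h1 : ERhoGt S c = ∫ ω in {ω | c < (S.ρ ω : EReal)}, S.ρ ω ∂S.P := by
    rw [← integral_indicator hm, ERhoGt]
    refine integral_congr_ae (ae_of_all _ fun ω => ?_)
    by_cases h : c < (S.ρ ω : EReal) <;> simp [h]
  rw [h1, integral_eq_lintegral_of_nonneg_ae
    (ae_restrict_of_ae (S.ρ_pos.mono fun _ h => h.le)) S.meas_ρ.aestronglyMeasurable,
    priceMeasure, withDensity_apply _ hm]

/-- If `Y` vanishes on `B` then there is a level `c` with `P{ρ > c} = P(B)` for which `{ρ ≤ c}`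
does at least as well as `Bᶜ` in the positive part problem. -/
theorem exists_level {Y : Ω → ℝ} (hY : Measurable Y) (h0 : ∀ ω, 0 ≤ Y ω)
    (hi : Integrable (fun ω => S.ρ ω * Y ω) S.P) {x : ℝ} (hx : ∫ ω, S.ρ ω * Y ω ∂S.P = x)
    (hx0 : max S.x0 0 ≤ x) {B : Set Ω} (hB : MeasurableSet B) (hB0 : S.P B ≠ 0)
    (hYB : ∀ ω ∈ B, Y ω = 0) :
    ∃ c, FeasSc S c x ∧ (Vpl S Y : EReal) ≤ vPos S (lev S c) x ∧
      (S.P B).toReal = 1 - FdistE S c ∧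
      S.priceMeasure B ≤ S.priceMeasure {ω | c < (S.ρ ω : EReal)} := by
  by_cases hB1 : S.P B = 1
  · have hae : ∀ᵐ ω ∂S.P, Y ω = 0 := by
      have h1 : ∀ᵐ ω ∂S.P, ω ∈ B := (prob_compl_eq_zero_iff hB).2 hB1
      exact h1.mono hYB
    have hxz : x = 0 := by
      rw [← hx]
      refine integral_eq_zero_of_ae ?_
      filter_upwards [hae] with ω hω
      simp [hω]
    have hlt : rhoLow S < rhoBar S := S.rhoLow_lt (by simp [S.measure_lev_rhoBar])
    refine ⟨rhoLow S, ⟨le_rfl, hlt.le, hx0, fun _ => hxz, fun h => absurd h hlt.ne⟩, ?_, ?_, ?_⟩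
    · rw [S.Vpl_eq_zero hae, vPos, if_pos S.measure_lev_rhoLow, if_pos hxz]
      simp
    · have h1 : FdistE S (rhoLow S) = 0 := by
        rw [FdistE, show {ω | (S.ρ ω : EReal) ≤ rhoLow S} = lev S (rhoLow S) from rfl,
          S.measure_lev_rhoLow, ENNReal.toReal_zero]
      rw [h1, hB1]
      simp
    · rw [← S.compl_lev]
      refine (measure_mono (subset_univ B)).trans ?_
      rw [← measure_add_measure_compl (S.measurableSet_lev (rhoLow S)),
        S.priceMeasure_absolutelyContinuous S.measure_lev_rhoLow, zero_add]
  · have hp0 : 0 < (S.P B).toReal := ENNReal.toReal_pos hB0 (measure_ne_top _ _)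
    have hp1 : (S.P B).toReal < 1 := by
      refine lt_of_le_of_ne (S.toReal_mem_Icc B).2 fun h => hB1 ?_
      rw [← ENNReal.ofReal_toReal (measure_ne_top S.P B), h, ENNReal.ofReal_one]
    obtain ⟨d, hd⟩ := S.exists_Fdist_eq (v := 1 - (S.P B).toReal) (by linarith) (by linarith)
    have hlev : lev S d = {ω | S.ρ ω ≤ d} := by
      ext ω
      simp [lev]
    have hgt : {ω | ((d : ℝ) : EReal) < (S.ρ ω : EReal)} = {ω | d < S.ρ ω} := by
      ext ω
      simp
    have hFd : FdistE S d = Fdist S d := by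
      rw [FdistE, Fdist, ← hlev]
      rfl
    have hCm : MeasurableSet {ω | S.ρ ω ≤ d} := measurableSet_le S.meas_ρ measurable_const
    have hPc : S.P {ω | S.ρ ω ≤ d} = S.P Bᶜ := by
      rw [← ENNReal.toReal_eq_toReal_iff' (measure_ne_top _ _) (measure_ne_top _ _)]
      refine hd.trans ?_
      rw [prob_compl_eq_one_sub hB, ENNReal.toReal_sub_of_le prob_le_one ENNReal.one_ne_top,
        ENNReal.toReal_one]
    have hne0 : S.P {ω | S.ρ ω ≤ d} ≠ 0 := fun h => by
      rw [Fdist, h, ENNReal.toReal_zero] at hd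
      linarith
    have hne1 : S.P {ω | S.ρ ω ≤ d} ≠ 1 := fun h => by
      rw [Fdist, h, ENNReal.toReal_one] at hd
      linarith
    have hlow := S.rhoLow_lt (c := d) (by rwa [hlev])
    have hbar := S.lt_rhoBar (c := d) (by rwa [hlev])
    refine ⟨d, ⟨hlow.le, hbar.le, hx0, fun h => absurd h hlow.ne', fun h => absurd h hbar.ne⟩,
      ?_, ?_, ?_⟩
    · rw [← hx]
      refine S.Vpl_le_vPos_lev hY h0 hi hne0 ?_
      rw [hPc]
      exact measure_mono fun ω (hω : 0 < Y ω) hb => hω.ne' (hYB ω hb)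
    · rw [hFd, hd]
      ring
    · rw [hgt]
      refine S.priceMeasure_ge_of_measure_eq hB ?_
      have h1 : {ω | d < S.ρ ω} = {ω | S.ρ ω ≤ d}ᶜ := by
        ext ω
        simp
      rw [h1, prob_compl_eq_one_sub hCm, hPc, ← prob_compl_eq_one_sub hB.compl, compl_compl]

theorem Vval_le_of_objM_le_of_measurable (hfin : FinCond S) {M : EReal}
    (hM : ∀ c x, FeasSc S c x → objM S c x ≤ M) {X : Ω → ℝ} (hX : Measurable X)
    (hi : Integrable (fun ω => S.ρ ω * X ω) S.P) (hx : ∫ ω, S.ρ ω * X ω ∂S.P = S.x0) :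
    Vval S X ≤ M := by
  set Y : Ω → ℝ := fun ω => max (X ω) 0 with hYd
  set Z : Ω → ℝ := fun ω => max (-X ω) 0 with hZd
  have hY : Measurable Y := hX.max measurable_const
  have hZ : Measurable Z := hX.neg.max measurable_const
  have hY0 : ∀ ω, 0 ≤ Y ω := fun ω => le_max_right _ _
  have hZ0 : ∀ ω, 0 ≤ Z ω := fun ω => le_max_right _ _
  have hYi : Integrable (fun ω => S.ρ ω * Y ω) S.P := by
    refine hi.pos_part.congr ?_
    filter_upwards [S.ρ_pos] with ω h
    rw [hYd, mul_max_of_nonneg _ _ h.le, mul_zero]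
  have hZi : Integrable (fun ω => S.ρ ω * Z ω) S.P := by
    refine hi.neg_part.congr ?_
    filter_upwards [S.ρ_pos] with ω h
    rw [hZd, mul_max_of_nonneg _ _ h.le, mul_zero, mul_neg]
  set x := ∫ ω, S.ρ ω * Y ω ∂S.P with hxd
  set a := ∫ ω, S.ρ ω * Z ω ∂S.P with had
  have hxa : x - a = S.x0 := by
    rw [← hx, hxd, had, ← integral_sub hYi hZi]
    refine integral_congr_ae (ae_of_all _ fun ω => ?_)
    simp only [hYd, hZd, ← mul_sub]
    rcases le_total 0 (X ω) with h | h <;> simp [h]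
  have hx0 : 0 ≤ x := integral_nonneg_of_ae (S.ae_mul_nonneg hY0)
  have ha0 : 0 ≤ a := integral_nonneg_of_ae (S.ae_mul_nonneg hZ0)
  have hmax : max S.x0 0 ≤ x := max_le (by linarith) hx0
  have hVfin : Vpl S Y ≠ ⊤ := (hfin Y hY.aemeasurable (ae_of_all _ hY0) hYi).ne
  rcases ha0.eq_or_lt with ha | ha
  · have hlt : rhoLow S < rhoBar S := S.rhoLow_lt (by simp [S.measure_lev_rhoBar])
    have hxx : x = S.x0 := by linarith
    refine le_trans ?_ (hM (rhoBar S) x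
      ⟨hlt.le, le_rfl, hmax, fun h => absurd h hlt.ne', fun _ => hxx⟩)
    rw [objM, hxx, sub_self, zero_div, S.um_zero, zero_mul, EReal.coe_zero, sub_zero, vPos,
      if_neg (by simp [S.measure_lev_rhoBar])]
    refine le_trans ?_ (le_sSup ⟨Y, ⟨hY.aemeasurable, ae_of_all _ hY0, hYi, hxx, ?_⟩, rfl⟩)
    · refine (EReal.sub_le_sub le_rfl (EReal.coe_ennreal_nonneg _)).trans ?_
      rw [sub_zero]
    · filter_upwards [S.ae_le_rhoBar] with ω h1 h2
      exact absurd h1 h2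
  · by_contra hlt
    obtain ⟨r, hr1, hr2⟩ := EReal.lt_iff_exists_real_btwn.1 (not_le.1 hlt)
    set v := (Vpl S Y).toReal with hv
    have hVv : (Vpl S Y : EReal) = (v : EReal) := (EReal.coe_ennreal_toReal hVfin).symm
    have hkey : ENNReal.ofReal (v - r) ≤ Vmn S Z := by
      refine S.ofReal_le_Vmn hZ hZ0 ha (S.lintegral_priceMeasure_eq_ofReal hZ hZ0 hZi)
        fun t ht hw => ?_
      have hB : MeasurableSet {ω | t < Z ω} := measurableSet_lt measurable_const hZ
      obtain ⟨c, hc, hVc, hPc, hνc⟩ := S.exists_level hY hY0 hYi rfl hmax hB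
        (fun h => hw (S.priceMeasure_absolutelyContinuous h)) (fun ω (hω : t < Z ω) => by
          have h1 : 0 < -X ω := by
            by_contra h2
            simp only [hZd, max_eq_right (not_lt.1 h2)] at hω
            linarith
          exact max_eq_right (by linarith))
      have hwp : 0 < (S.priceMeasure {ω | t < Z ω}).toReal :=
        ENNReal.toReal_pos hw (measure_ne_top _ _)
      have hwE : (S.priceMeasure {ω | t < Z ω}).toReal ≤ ERhoGt S c := by
        rw [S.ERhoGt_eq]
        exact ENNReal.toReal_mono (measure_ne_top _ _) hνc
      have h1 := (hM c x hc).trans hr1.le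
      have h2 := (EReal.sub_le_sub hVc le_rfl).trans h1
      rw [hVv, ← EReal.coe_sub, EReal.coe_le_coe_iff, ← hPc, show x - S.x0 = a by linarith] at h2
      have h3 : S.um (a / ERhoGt S c) ≤ S.um (a / (S.priceMeasure {ω | t < Z ω}).toReal) :=
        S.um_mono.monotoneOn (mem_Ici.2 (div_nonneg ha.le (hwp.le.trans hwE)))
          (mem_Ici.2 (by positivity)) (div_le_div_of_nonneg_left ha.le hwp hwE)
      have h4 := mul_le_mul_of_nonneg_right h3 (S.Tm_measure_nonneg {ω | t < Z ω})
      linarith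
    have h1 : ((v - r : ℝ) : EReal) ≤ (Vmn S Z : EReal) := by
      refine le_trans ?_ (EReal.coe_ennreal_le_coe_ennreal_iff.2 hkey)
      rw [EReal.coe_ennreal_ofReal]
      exact EReal.coe_le_coe_iff.2 (le_max_left _ _)
    have h2 : Vval S X ≤ ((v - (v - r) : ℝ) : EReal) := by
      rw [EReal.coe_sub]
      exact EReal.sub_le_sub hVv.le h1
    rw [sub_sub_cancel] at h2
    exact absurd hr2 (not_lt.2 h2)

theorem Vval_le_of_objM_le (hfin : FinCond S) {M : EReal}
    (hM : ∀ c x, FeasSc S c x → objM S c x ≤ M) {X : Ω → ℝ} (hX : FeasP S X) :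
    Vval S X ≤ M := by
  obtain ⟨hm, -, hi, hx⟩ := hX
  have hae : (fun ω => S.ρ ω * X ω) =ᵐ[S.P] fun ω => S.ρ ω * hm.mk X ω := by
    filter_upwards [hm.ae_eq_mk] with ω h
    rw [h]
  rw [S.Vval_congr_ae hm.ae_eq_mk]
  exact S.Vval_le_of_objM_le_of_measurable hfin hM hm.measurable_mk (hi.congr hae)
    ((integral_congr_ae hae).symm.trans hx)

theorem Vmn_indicator_le {A : Set Ω} {k : ℝ} (hk : 0 ≤ k) :
    Vmn S (A.indicator fun _ => k) ≤ ENNReal.ofReal (S.um k * S.Tm (S.P A).toReal) := by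
  have h1 : ∀ y ∈ Ioi (0:ℝ),
      ENNReal.ofReal (S.Tm (S.P {ω | y < S.um (A.indicator (fun _ => k) ω)}).toReal)
        ≤ (Ioo 0 (S.um k)).indicator (fun _ => ENNReal.ofReal (S.Tm (S.P A).toReal)) y := by
    intro y (hy : 0 < y)
    have hA : {ω | y < S.um (A.indicator (fun _ => k) ω)} ⊆ A := fun ω hω => by
      by_contra h
      simp only [mem_ofPred_eq, indicator_of_notMem h, S.um_zero] at hω
      linarith
    rcases lt_or_ge y (S.um k) with h | h
    · rw [indicator_of_mem (show y ∈ Ioo 0 (S.um k) from ⟨hy, h⟩)]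
      exact ENNReal.ofReal_le_ofReal (S.Tm_measure_mono hA)
    · have h2 : {ω | y < S.um (A.indicator (fun _ => k) ω)} = ∅ := by
        refine eq_empty_of_forall_notMem fun ω hω => ?_
        have h3 := hA hω
        simp only [mem_ofPred_eq, indicator_of_mem h3] at hω
        linarith
      rw [h2]
      simp [S.Tm_zero]
  calc Vmn S (A.indicator fun _ => k)
      ≤ ∫⁻ y in Ioi 0,
          (Ioo 0 (S.um k)).indicator (fun _ => ENNReal.ofReal (S.Tm (S.P A).toReal)) y :=
        setLIntegral_mono' measurableSet_Ioi h1
    _ ≤ ∫⁻ y, (Ioo 0 (S.um k)).indicator (fun _ => ENNReal.ofReal (S.Tm (S.P A).toReal)) y :=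
        setLIntegral_le_lintegral _ _
    _ = ENNReal.ofReal (S.um k * S.Tm (S.P A).toReal) := by
        rw [lintegral_indicator_const measurableSet_Ioo, Real.volume_Ioo, sub_zero, mul_comm,
          ENNReal.ofReal_mul (S.um_nonneg hk)]

theorem vPos_le_Vpl {A : Set Ω} {x : ℝ} {X : Ω → ℝ} (hX : OptPos S A x X) :
    vPos S A x ≤ (Vpl S X : EReal) := by
  rw [vPos]
  split_ifs
  · exact EReal.coe_ennreal_nonneg _
  · exact bot_le
  · refine sSup_le ?_
    rintro v ⟨Y, hY, rfl⟩
    exact EReal.coe_ennreal_le_coe_ennreal_iff.2 (hX.2 Y hY)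

end BSetup

/-- Theorem 4.1 (ii): if `(c*, x₊*)` is optimal for Problem (M)
and `X₊*` is optimal for the positive part problem with parameters
`({ρ ≤ c*}, x₊*)`, then
`X* = X₊*·1_{ρ≤c*} − ((x₊* − x₀)/E[ρ1_{ρ>c*}])·1_{ρ>c*}` is optimal for (P). -/
theorem optimalM_implies_optimalP (S : BSetup Ω)
    (hfin : FinCond S) (hum : StrictConcaveAtZero S.um)
    (cstar : EReal) (xps : ℝ) (hM : OptM S cstar xps)
    (Xp : Ω → ℝ) (hXp : OptPos S (lev S cstar) xps Xp) :
    OptimalP S (fun ω =>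
      (if (S.ρ ω : EReal) ≤ cstar then Xp ω else 0) -
        (if cstar < (S.ρ ω : EReal) then (xps - S.x0) / ERhoGt S cstar else 0)) := by
  obtain ⟨hfeas, hbound⟩ := hM
  obtain ⟨hXm, hX0, hXi, hXx, hXv⟩ := hXp.1
  obtain ⟨-, hcbar, hxmax, -, hxbar⟩ := hfeas
  set k := (xps - S.x0) / ERhoGt S cstar with hk
  have hE0 : 0 ≤ ERhoGt S cstar := by
    rw [S.ERhoGt_eq]
    exact ENNReal.toReal_nonneg
  have hk0 : 0 ≤ k := div_nonneg (by linarith [le_max_left S.x0 0]) hE0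
  set B : Set Ω := {ω | cstar < (S.ρ ω : EReal)} with hB
  have hBm : MeasurableSet B := measurableSet_lt measurable_const S.measurable_ereal
  have hkE : k * ERhoGt S cstar = xps - S.x0 := by
    by_cases hE : ERhoGt S cstar = 0
    · have h1 : S.P (lev S cstar) = 1 := by
        rw [← prob_compl_eq_zero_iff (S.measurableSet_lev cstar), S.compl_lev]
        refine S.absolutelyContinuous_priceMeasure ?_
        rw [S.ERhoGt_eq] at hE
        exact ((ENNReal.toReal_eq_zero_iff _).1 hE).resolve_right (measure_ne_top _ _)
      have h2 : rhoBar S ≤ cstar := essSup_le_of_ae_le _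
        ((prob_compl_eq_zero_iff (S.measurableSet_lev cstar)).2 h1)
      rw [hE, mul_zero, hxbar (le_antisymm hcbar h2), sub_self]
    · rw [hk, div_mul_cancel₀ _ hE]
  have hae : (fun ω => (if (S.ρ ω : EReal) ≤ cstar then Xp ω else 0) -
      (if cstar < (S.ρ ω : EReal) then k else 0)) =ᵐ[S.P]
      fun ω => Xp ω - B.indicator (fun _ => k) ω := by
    filter_upwards [hXv] with ω h
    by_cases hω : (S.ρ ω : EReal) ≤ cstar
    · have h1 : ω ∉ B := not_lt.2 hω
      simp [hω, h1, not_lt.2 hω]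
    · have h1 : ω ∈ B := not_le.1 hω
      simp [hω, h1, not_le.1 hω, h hω]
  have hρB : Integrable (fun ω => S.ρ ω * B.indicator (fun _ => k) ω) S.P := by
    refine ((S.ρ_int.mul_const k).indicator hBm).congr (ae_of_all _ fun ω => ?_)
    by_cases h : ω ∈ B <;> simp [h]
  have hρBx : ∫ ω, S.ρ ω * B.indicator (fun _ => k) ω ∂S.P = xps - S.x0 := by
    rw [← hkE, ERhoGt, ← integral_const_mul]
    refine integral_congr_ae (ae_of_all _ fun ω => ?_)
    by_cases h : cstar < (S.ρ ω : EReal)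
    · have h1 : ω ∈ B := h
      simp [h, h1, mul_comm]
    · have h1 : ω ∉ B := h
      simp [h, h1]
  have hmul : (fun ω => S.ρ ω * Xp ω - S.ρ ω * B.indicator (fun _ => k) ω) =ᵐ[S.P]
      fun ω => S.ρ ω * ((if (S.ρ ω : EReal) ≤ cstar then Xp ω else 0) -
        (if cstar < (S.ρ ω : EReal) then k else 0)) := by
    filter_upwards [hae] with ω h
    rw [h, mul_sub]
  refine ⟨⟨?_, ⟨-k, ?_⟩, (hXi.sub hρB).congr hmul, ?_⟩, fun Y hY => ?_⟩
  · exact (hXm.sub (measurable_const.indicator hBm).aemeasurable).congr hae.symm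
  · filter_upwards [hae, hX0] with ω h h1
    rw [h]
    have h2 : B.indicator (fun _ => k) ω ≤ k := indicator_le_self' (fun _ _ => hk0) ω
    linarith
  · rw [← integral_congr_ae hmul, integral_sub hXi hρB, hXx, hρBx]
    ring
  · refine (S.Vval_le_of_objM_le hfin hbound hY).trans ?_
    rw [S.Vval_congr_ae hae, Vval, objM]
    have hpos : (fun ω => max (Xp ω - B.indicator (fun _ => k) ω) 0) =ᵐ[S.P] Xp := by
      filter_upwards [hX0, hXv] with ω h h1
      by_cases hω : ω ∈ B
      · have h2 : Xp ω = 0 := h1 fun (h3 : (S.ρ ω : EReal) ≤ cstar) =>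
          absurd (show cstar < (S.ρ ω : EReal) from hω) (not_lt.2 h3)
        simp [hω, h2, hk0]
      · simp [hω, h]
    have hneg : (fun ω => max (-(Xp ω - B.indicator (fun _ => k) ω)) 0) =ᵐ[S.P]
        B.indicator fun _ => k := by
      filter_upwards [hX0, hXv] with ω h h1
      by_cases hω : ω ∈ B
      · have h2 : Xp ω = 0 := h1 fun (h3 : (S.ρ ω : EReal) ≤ cstar) =>
          absurd (show cstar < (S.ρ ω : EReal) from hω) (not_lt.2 h3)
        simp [hω, h2, hk0]
      · simp [hω, h]
    rw [S.Vpl_congr_ae hpos, S.Vmn_congr_ae hneg]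
    refine EReal.sub_le_sub (S.vPos_le_Vpl hXp) ?_
    have hPB : (S.P B).toReal = 1 - FdistE S cstar := by
      rw [hB, ← S.compl_lev, prob_compl_eq_one_sub (S.measurableSet_lev cstar),
        ENNReal.toReal_sub_of_le prob_le_one ENNReal.one_ne_top, ENNReal.toReal_one]
      rfl
    refine (EReal.coe_ennreal_le_coe_ennreal_iff.2 (S.Vmn_indicator_le hk0)).trans ?_
    rw [EReal.coe_ennreal_ofReal, max_eq_left
      (mul_nonneg (S.um_nonneg hk0) (S.Tm_measure_nonneg B)), hPB]

end
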